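/- Existence of the refined-profile correction (Lemma on z̃_R): there exist constants C₁ > 0 and δ₁ > 0 and a map z̃_R from the open ball D = {z ∈ ℂ² : |z| < δ₁} to ℂ² such that: (i) for every z ∈ D and every Θ ∈ ℂ², the orthogonality relation ∫_ℝ [ (Φ̃[z̃_R(z)]₂ + R̂[z]₂)(x) · conj(Φ̃[Θ]₁(x)) - (Φ̃[z̃_R(z)]₁ + R̂[z]₁)(x) · conj(Φ̃[Θ]₂(x)) ] dx = 0 holds; (ii) |z̃_R(z)| ≤ C₁ |z|² for every z ∈ D; (iii) z̃_R is continuously differentiable on D (as a map between the underlying real vector spaces); and (iv) z̃_R is twice differentiable at z = 0. -/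

import Mathlib

open Real

/-- The soliton `Q(x) = ((p+1)/2)^{1/(p-1)} (sech(β₀x))^{2/(p-1)}` with `β₀ = (p-1)/2`,
where `sech t = 1 / cosh t`. -/
noncomputable def solitonQ (p : ℝ) : ℝ → ℝ :=
  fun x => ((p + 1) / 2) ^ (1 / (p - 1)) * ((Real.cosh ((p - 1) / 2 * x))⁻¹) ^ (2 / (p - 1))

/-- The nonlinearity `f(u) = |u|^{p-1} u`. -/
noncomputable def fNL (p : ℝ) : ℝ → ℝ :=
  fun u => |u| ^ (p - 1) * u

/-- The operator `(S_j* g)(x) = -g'(x) - k tanh(β₀x) g(x)` with `β₀ = (p-1)/2`,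
for a constant `k`. -/
noncomputable def Sstar (p k : ℝ) (g : ℝ → ℝ) : ℝ → ℝ :=
  fun x => -(deriv g x) - k * Real.tanh ((p - 1) / 2 * x) * g x

/-- `φ₀ = Q^{k₀}` with `k₀ = (p+1)/2`. -/
noncomputable def phi0 (p : ℝ) : ℝ → ℝ :=
  fun x => solitonQ p x ^ ((p + 1) / 2)

/-- `φ₂ = S₀*(S₁*(Q^{k₂}))` where `k₀ = (p+1)/2`, `k₁ = 1`, `k₂ = (3-p)/2`. -/
noncomputable def phi2 (p : ℝ) : ℝ → ℝ :=
  Sstar p ((p + 1) / 2) (Sstar p 1 (fun x => solitonQ p x ^ ((3 - p) / 2)))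

/-- `ν₀ = sqrt(k₀² - 1)` with `k₀ = (p+1)/2`. -/
noncomputable def nu0 (p : ℝ) : ℝ := Real.sqrt (((p + 1) / 2) ^ 2 - 1)

/-- `λ = sqrt(1 - k₂²)` with `k₂ = (3-p)/2`. -/
noncomputable def lam (p : ℝ) : ℝ := Real.sqrt (1 - ((3 - p) / 2) ^ 2)

/-- First component of `Φ̃[w] = w₁Φ₀ + w₂Φ₂ + conj(w₁)conj(Φ₀) + conj(w₂)conj(Φ₂)`,
where `Φ₀ = (((1-i)/2)φ₀, ((1+i)/2)ν₀φ₀)` and `Φ₂ = (φ₂, iλφ₂)`; it is real-valued,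
equal to `2 Re(w₁ (1-i)/2) φ₀ + 2 Re(w₂) φ₂`. -/
noncomputable def tildePhi1 (p : ℝ) (w : ℂ × ℂ) : ℝ → ℝ :=
  fun x => 2 * (w.1 * ((1 - Complex.I) / 2)).re * phi0 p x + 2 * w.2.re * phi2 p x

/-- Second component of `Φ̃[w]`; it is real-valued, equal to
`2 Re(w₁ (1+i)/2) ν₀ φ₀ + 2 Re(w₂ i) λ φ₂`. -/
noncomputable def tildePhi2 (p : ℝ) (w : ℂ × ℂ) : ℝ → ℝ :=
  fun x => 2 * (w.1 * ((1 + Complex.I) / 2)).re * nu0 p * phi0 p x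
    + 2 * (w.2 * Complex.I).re * lam p * phi2 p x

/-- First component of `R̂[z]`, which vanishes. -/
noncomputable def hatR1 (p : ℝ) (z : ℂ × ℂ) : ℝ → ℝ := fun _ => 0

/-- Second component of `R̂[z] = (0, -(f(Φ[z]₁) - f(Q) - p Q^{p-1} Φ̃[z]₁))`,
where `Φ[z]₁ = Q + Φ̃[z]₁`. -/
noncomputable def hatR2 (p : ℝ) (z : ℂ × ℂ) : ℝ → ℝ :=
  fun x => -(fNL p (solitonQ p x + tildePhi1 p z x) - fNL p (solitonQ p x)
    - p * solitonQ p x ^ (p - 1) * tildePhi1 p z x)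

open MeasureTheory Filter Topology

theorem abs_abs_rpow_sub_one_le {r : ℝ} (hr0 : 0 < r) (hr1 : r ≤ 1) (y : ℝ) :
    |(|y| ^ r - 1)| ≤ |y - 1| := by
  have key : |(|y| ^ r - 1)| ≤ |(|y| - 1)| := by
    rcases le_total 1 |y| with h | h
    · have h1 : 1 ≤ |y| ^ r := Real.one_le_rpow h hr0.le
      have h2 : |y| ^ r ≤ |y| := Real.rpow_le_self_of_one_le h hr1
      rw [abs_of_nonneg (sub_nonneg.2 h1), abs_of_nonneg (sub_nonneg.2 h)]
      linarith
    · have h1 : |y| ^ r ≤ 1 := Real.rpow_le_one (abs_nonneg y) h hr0.le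
      have h2 : |y| ≤ |y| ^ r := Real.self_le_rpow_of_le_one (abs_nonneg y) h hr1
      rw [abs_of_nonpos (sub_nonpos.2 h1), abs_of_nonpos (sub_nonpos.2 h)]
      linarith
  refine key.trans ?_
  simpa using abs_abs_sub_abs_le_abs_sub y 1

theorem abs_abs_add_rpow_sub_le {r : ℝ} (hr0 : 0 < r) (hr1 : r ≤ 1) {a : ℝ} (ha : 0 < a) (u : ℝ) :
    |(|a + u| ^ r - a ^ r)| ≤ a ^ (r - 1) * |u| := by
  have h1 : a + u = a * (1 + u / a) := by field_simp
  have h2 : |a + u| ^ r - a ^ r = a ^ r * (|1 + u / a| ^ r - 1) := by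
    rw [h1, abs_mul, abs_of_pos ha, Real.mul_rpow ha.le (abs_nonneg _)]
    ring
  have h3 := abs_abs_rpow_sub_one_le hr0 hr1 (1 + u / a)
  rw [h2, abs_mul, abs_of_pos (Real.rpow_pos_of_pos ha r), Real.rpow_sub_one ha.ne']
  rw [add_sub_cancel_left, abs_div, abs_of_pos ha] at h3
  calc a ^ r * |(|1 + u / a| ^ r - 1)| ≤ a ^ r * (|u| / a) := by gcongr
    _ = a ^ r / a * |u| := by ring

theorem continuous_fNL {p : ℝ} (hp : 1 < p) : Continuous (fNL p) :=
  (continuous_abs.rpow_const fun _ => Or.inr (by linarith)).mul continuous_id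

theorem hasDerivAt_fNL {p : ℝ} (hp : 1 < p) (u : ℝ) :
    HasDerivAt (fNL p) (p * |u| ^ (p - 1)) u := by
  have hne : ∀ y : ℝ, y ≠ 0 → HasDerivAt (fNL p) (p * |y| ^ (p - 1)) y := by
    intro y hy
    have h := ((hasDerivAt_abs hy).rpow_const (p := p - 1) (Or.inl (abs_ne_zero.2 hy))).mul
      (hasDerivAt_id y)
    refine h.congr_deriv ?_
    have hs : (SignType.sign y : ℝ) * y = |y| := by
      rcases lt_or_gt_of_ne hy with h | h
      · simp [h, abs_of_neg]
      · simp [h, abs_of_pos]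
    rw [Real.rpow_sub_one (abs_ne_zero.2 hy) (p - 1)]
    have h0 : |y| ≠ 0 := abs_ne_zero.2 hy
    simp only [id]
    field_simp
    rw [← hs]
    ring
  by_cases hu : u = 0
  · subst hu
    refine hasDerivAt_of_hasDerivAt_of_ne (g := fun y => p * |y| ^ (p - 1)) hne
      (continuous_fNL hp).continuousAt ?_
    exact (continuous_const.mul
      (continuous_abs.rpow_const fun _ => Or.inr (by linarith))).continuousAt
  · exact hne u hu

theorem abs_fNL_taylor_le {p : ℝ} (hp1 : 1 < p) (hp2 : p ≤ 2) {a : ℝ} (ha : 0 < a) (u : ℝ) :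
    |fNL p (a + u) - fNL p a - p * a ^ (p - 1) * u| ≤ p * a ^ (p - 2) * |u| ^ 2 := by
  have hd : ∀ t ∈ Set.uIcc 0 u, HasDerivWithinAt (fun t => fNL p (a + t) - p * a ^ (p - 1) * t)
      (p * (|a + t| ^ (p - 1) - a ^ (p - 1))) (Set.uIcc 0 u) t := by
    intro t _
    have h := ((hasDerivAt_fNL hp1 (a + t)).comp_const_add a t).sub
      ((hasDerivAt_id t).const_mul (p * a ^ (p - 1)))
    exact (h.congr_deriv (by ring)).hasDerivWithinAt
  have hb : ∀ t ∈ Set.uIcc 0 u, ‖p * (|a + t| ^ (p - 1) - a ^ (p - 1))‖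
      ≤ p * a ^ (p - 2) * |u| := by
    intro t ht
    have h := abs_abs_add_rpow_sub_le (r := p - 1) (by linarith) (by linarith) ha t
    have htu : |t| ≤ |u| := by
      simpa using Set.abs_sub_left_of_mem_uIcc ht
    rw [Real.norm_eq_abs, abs_mul, abs_of_pos (by linarith : 0 < p), mul_assoc]
    rw [show p - 1 - 1 = p - 2 by ring] at h
    have : 0 < a ^ (p - 2) := Real.rpow_pos_of_pos ha _
    gcongr
    exact h.trans (by gcongr)
  have := Convex.norm_image_sub_le_of_norm_hasDerivWithin_le hd hb (convex_uIcc 0 u)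
    Set.left_mem_uIcc Set.right_mem_uIcc
  simp only [Real.norm_eq_abs, add_zero, mul_zero, sub_zero] at this
  calc _ = |fNL p (a + u) - p * a ^ (p - 1) * u - fNL p a| := by congr 1; ring
    _ ≤ _ := this
    _ = _ := by ring

section Remainder

variable {E : Type*} [NormedAddCommGroup E] [NormedSpace ℝ E]

/-- The second order Taylor remainder of `fNL p` at `q x` in the direction `L x z`, weighted by
`ψ x`. -/
noncomputable def taylorRem (p : ℝ) (q ψ : ℝ → ℝ) (L : ℝ → E →L[ℝ] ℝ) (z : E) (x : ℝ) : ℝ :=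
  (fNL p (q x + L x z) - fNL p (q x) - p * q x ^ (p - 1) * L x z) * ψ x

/-- The derivative of `taylorRem p q ψ L` in the variable `z`. -/
noncomputable def taylorRemDeriv (p : ℝ) (q ψ : ℝ → ℝ) (L : ℝ → E →L[ℝ] ℝ) (z : E) (x : ℝ) :
    E →L[ℝ] ℝ :=
  (p * (|q x + L x z| ^ (p - 1) - q x ^ (p - 1)) * ψ x) • L x

variable {p : ℝ} {q ψ : ℝ → ℝ} {L : ℝ → E →L[ℝ] ℝ}

theorem norm_taylorRem_le (hp1 : 1 < p) (hp2 : p ≤ 2) (hq0 : ∀ x, 0 < q x) (z : E) (x : ℝ) :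
    ‖taylorRem p q ψ L z x‖ ≤ p * ‖z‖ ^ 2 * (q x ^ (p - 2) * ‖L x‖ ^ 2 * |ψ x|) := by
  have h := abs_fNL_taylor_le hp1 hp2 (hq0 x) (L x z)
  have hL : |L x z| ≤ ‖L x‖ * ‖z‖ := (L x).le_opNorm z
  have : 0 < q x ^ (p - 2) := Real.rpow_pos_of_pos (hq0 x) _
  rw [taylorRem, Real.norm_eq_abs, abs_mul]
  calc _ ≤ p * q x ^ (p - 2) * |L x z| ^ 2 * |ψ x| := by gcongr
    _ ≤ p * q x ^ (p - 2) * (‖L x‖ * ‖z‖) ^ 2 * |ψ x| := by gcongr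
    _ = _ := by ring

theorem norm_taylorRemDeriv_le (hp1 : 1 < p) (hp2 : p ≤ 2) (hq0 : ∀ x, 0 < q x) (z : E) (x : ℝ) :
    ‖taylorRemDeriv p q ψ L z x‖ ≤ p * ‖z‖ * (q x ^ (p - 2) * ‖L x‖ ^ 2 * |ψ x|) := by
  have h := abs_abs_add_rpow_sub_le (r := p - 1) (by linarith) (by linarith) (hq0 x) (L x z)
  rw [show p - 1 - 1 = p - 2 by ring] at h
  have hL : |L x z| ≤ ‖L x‖ * ‖z‖ := (L x).le_opNorm z
  have : 0 < q x ^ (p - 2) := Real.rpow_pos_of_pos (hq0 x) _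
  rw [taylorRemDeriv, norm_smul, Real.norm_eq_abs, abs_mul, abs_mul, abs_of_pos (by linarith : 0 < p)]
  calc _ ≤ p * (q x ^ (p - 2) * (‖L x‖ * ‖z‖)) * |ψ x| * ‖L x‖ := by
        gcongr
        exact h.trans (by gcongr)
    _ = _ := by ring

theorem hasFDerivAt_taylorRem (hp1 : 1 < p) (z : E) (x : ℝ) :
    HasFDerivAt (fun z => taylorRem p q ψ L z x) (taylorRemDeriv p q ψ L z x) z := by
  have h1 : HasFDerivAt (fun z => q x + L x z) (L x) z := (L x).hasFDerivAt.const_add _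
  have h2 := (hasDerivAt_fNL hp1 (q x + L x z)).comp_hasFDerivAt z h1
  have h3 := ((h2.sub_const (fNL p (q x))).sub
    ((L x).hasFDerivAt.const_mul (p * q x ^ (p - 1)))).mul_const (ψ x)
  refine h3.congr_fderiv ?_
  ext v
  simp [taylorRemDeriv]
  ring

theorem hasFDerivAt_taylorRemDeriv_zero (hq0 : ∀ x, 0 < q x) (x : ℝ) :
    HasFDerivAt (fun z => taylorRemDeriv p q ψ L z x)
      (((p * (p - 1) * q x ^ (p - 2)) * ψ x) • (L x).smulRight (L x)) 0 := by
  have h1 : HasFDerivAt (fun z => q x + L x z) (L x) 0 := (L x).hasFDerivAt.const_add _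
  have hne : q x + L x 0 ≠ 0 := by simpa using (hq0 x).ne'
  have h2 := (((hasDerivAt_abs hne).rpow_const (p := p - 1)
    (Or.inl (abs_ne_zero.2 hne))).comp_hasFDerivAt 0 h1)
  have h3 := (((h2.sub_const (q x ^ (p - 1))).const_mul p).mul_const (ψ x)).smul_const (L x)
  refine h3.congr_fderiv ?_
  ext v w
  simp [abs_of_pos (hq0 x), sign_pos (hq0 x)]
  rw [show p - 1 - 1 = p - 2 by ring]
  ring

theorem continuous_taylorRem (hp1 : 1 < p) (hq : Continuous q) (hψ : Continuous ψ)
    (hL : Continuous L) (z : E) : Continuous (taylorRem p q ψ L z) := by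
  have hLz : Continuous fun x => L x z := hL.clm_apply continuous_const
  exact ((((continuous_fNL hp1).comp (hq.add hLz)).sub ((continuous_fNL hp1).comp hq)).sub
    ((continuous_const.mul (hq.rpow_const fun _ => Or.inr (by linarith))).mul hLz)).mul hψ

theorem continuous_taylorRemDeriv (hp1 : 1 < p) (hq : Continuous q) (hψ : Continuous ψ)
    (hL : Continuous L) (z : E) : Continuous (taylorRemDeriv p q ψ L z) := by
  have hLz : Continuous fun x => L x z := hL.clm_apply continuous_const
  exact ((continuous_const.mul (((hq.add hLz).abs.rpow_const fun _ => Or.inr (by linarith)).sub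
    (hq.rpow_const fun _ => Or.inr (by linarith)))).mul hψ).smul hL

theorem norm_integral_taylorRem_le (hp1 : 1 < p) (hp2 : p ≤ 2) (hq0 : ∀ x, 0 < q x)
    (hWint : Integrable fun x => q x ^ (p - 2) * ‖L x‖ ^ 2 * |ψ x|) (z : E) :
    ‖∫ x, taylorRem p q ψ L z x‖ ≤
      (p * ∫ x, q x ^ (p - 2) * ‖L x‖ ^ 2 * |ψ x|) * ‖z‖ ^ 2 := by
  refine (norm_integral_le_of_norm_le (hWint.const_mul (p * ‖z‖ ^ 2))
    (ae_of_all _ fun x => norm_taylorRem_le hp1 hp2 hq0 z x)).trans (le_of_eq ?_)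
  rw [integral_const_mul]
  ring

theorem integrable_taylorRem (hp1 : 1 < p) (hp2 : p ≤ 2) (hq : Continuous q)
    (hq0 : ∀ x, 0 < q x) (hψ : Continuous ψ) (hL : Continuous L)
    (hWint : Integrable fun x => q x ^ (p - 2) * ‖L x‖ ^ 2 * |ψ x|) (z : E) :
    Integrable (taylorRem p q ψ L z) :=
  (hWint.const_mul (p * ‖z‖ ^ 2)).mono' (continuous_taylorRem hp1 hq hψ hL z).aestronglyMeasurable
    (ae_of_all _ fun x => norm_taylorRem_le hp1 hp2 hq0 z x)

theorem hasFDerivAt_integral_taylorRem (hp1 : 1 < p) (hp2 : p ≤ 2) (hq : Continuous q)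
    (hq0 : ∀ x, 0 < q x) (hψ : Continuous ψ) (hL : Continuous L)
    (hWint : Integrable fun x => q x ^ (p - 2) * ‖L x‖ ^ 2 * |ψ x|) (z : E) :
    HasFDerivAt (fun z => ∫ x, taylorRem p q ψ L z x) (∫ x, taylorRemDeriv p q ψ L z x) z := by
  refine hasFDerivAt_integral_of_dominated_of_fderiv_le
    (bound := fun x => p * (‖z‖ + 1) * (q x ^ (p - 2) * ‖L x‖ ^ 2 * |ψ x|))
    (Metric.ball_mem_nhds z one_pos)
    (Eventually.of_forall fun w => (continuous_taylorRem hp1 hq hψ hL w).aestronglyMeasurable)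
    (integrable_taylorRem hp1 hp2 hq hq0 hψ hL hWint z)
    (continuous_taylorRemDeriv hp1 hq hψ hL z).aestronglyMeasurable
    (ae_of_all _ fun x w hw => ?_) (hWint.const_mul _)
    (ae_of_all _ fun x w _ => hasFDerivAt_taylorRem hp1 w x)
  refine (norm_taylorRemDeriv_le hp1 hp2 hq0 w x).trans ?_
  have h1 : ‖w‖ ≤ ‖z‖ + 1 := by
    have := norm_sub_norm_le w z
    rw [mem_ball_iff_norm] at hw
    linarith
  have : 0 < q x ^ (p - 2) := Real.rpow_pos_of_pos (hq0 x) _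
  gcongr

theorem contDiff_integral_taylorRem (hp1 : 1 < p) (hp2 : p ≤ 2) (hq : Continuous q)
    (hq0 : ∀ x, 0 < q x) (hψ : Continuous ψ) (hL : Continuous L)
    (hWint : Integrable fun x => q x ^ (p - 2) * ‖L x‖ ^ 2 * |ψ x|) :
    ContDiff ℝ 1 fun z => ∫ x, taylorRem p q ψ L z x := by
  have hd := hasFDerivAt_integral_taylorRem hp1 hp2 hq hq0 hψ hL hWint
  refine contDiff_one_iff_fderiv.2 ⟨fun z => (hd z).differentiableAt, ?_⟩
  rw [show fderiv ℝ (fun z => ∫ x, taylorRem p q ψ L z x) = fun z => ∫ x, taylorRemDeriv p q ψ L z x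
    from funext fun z => (hd z).fderiv]
  refine continuous_iff_continuousAt.2 fun z => ?_
  refine continuousAt_of_dominated
    (bound := fun x => p * (‖z‖ + 1) * (q x ^ (p - 2) * ‖L x‖ ^ 2 * |ψ x|))
    (Eventually.of_forall fun w => (continuous_taylorRemDeriv hp1 hq hψ hL w).aestronglyMeasurable)
    ?_ (hWint.const_mul _) (ae_of_all _ fun x => ?_)
  · filter_upwards [Metric.ball_mem_nhds z one_pos] with w hw
    refine ae_of_all _ fun x => (norm_taylorRemDeriv_le hp1 hp2 hq0 w x).trans ?_
    have h1 : ‖w‖ ≤ ‖z‖ + 1 := by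
      have := norm_sub_norm_le w z
      rw [mem_ball_iff_norm] at hw
      linarith
    have : 0 < q x ^ (p - 2) := Real.rpow_pos_of_pos (hq0 x) _
    gcongr
  · have : Continuous fun z => taylorRemDeriv p q ψ L z x :=
      ((continuous_const.mul (((continuous_const.add (L x).continuous).abs.rpow_const
        fun _ => Or.inr (by linarith)).sub continuous_const)).mul continuous_const).smul
        continuous_const
    exact this.continuousAt

set_option synthInstance.maxHeartbeats 200000 in
theorem differentiableAt_fderiv_integral_taylorRem (hp1 : 1 < p) (hp2 : p ≤ 2) (hq : Continuous q)
    (hq0 : ∀ x, 0 < q x) (hψ : Continuous ψ) (hL : Continuous L)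
    (hWint : Integrable fun x => q x ^ (p - 2) * ‖L x‖ ^ 2 * |ψ x|) :
    DifferentiableAt ℝ (fderiv ℝ fun z => ∫ x, taylorRem p q ψ L z x) 0 := by
  have hd := hasFDerivAt_integral_taylorRem hp1 hp2 hq hq0 hψ hL hWint
  rw [show fderiv ℝ (fun z => ∫ x, taylorRem p q ψ L z x) = fun z => ∫ x, taylorRemDeriv p q ψ L z x
    from funext fun z => (hd z).fderiv]
  have h0 : taylorRemDeriv p q ψ L 0 = 0 := by
    funext x
    simp [taylorRemDeriv, abs_of_pos (hq0 x)]
  refine (hasFDerivAt_integral_of_dominated_loc_of_lip' (𝕜 := ℝ) (s := Set.univ)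
    (bound := fun x => p * (q x ^ (p - 2) * ‖L x‖ ^ 2 * |ψ x|))
    (F' := fun x => ((p * (p - 1) * q x ^ (p - 2)) * ψ x) • (L x).smulRight (L x))
    Filter.univ_mem
    (fun w _ => (continuous_taylorRemDeriv hp1 hq hψ hL w).aestronglyMeasurable)
    (by rw [h0]; exact integrable_zero _ _ _) ?_ (ae_of_all _ fun x w _ => ?_) (hWint.const_mul _)
    (ae_of_all _ fun x => hasFDerivAt_taylorRemDeriv_zero hq0 x)).2.differentiableAt
  · refine Continuous.aestronglyMeasurable ?_
    have h1 : Continuous fun x => q x ^ (p - 2) := hq.rpow_const fun x => Or.inl (hq0 x).ne'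
    have h2 : Continuous fun x => (L x).smulRight (L x) :=
      ((ContinuousLinearMap.smulRightL ℝ E (E →L[ℝ] ℝ)).continuous.comp hL).clm_apply hL
    exact ((continuous_const.mul h1).mul hψ).smul h2
  · rw [h0]
    simp only [Pi.zero_apply, sub_zero]
    exact (norm_taylorRemDeriv_le hp1 hp2 hq0 w x).trans (le_of_eq (by ring))

end Remainder

section Soliton

theorem solitonQ_pos {p : ℝ} (hp : 1 < p) (x : ℝ) : 0 < solitonQ p x :=
  mul_pos (Real.rpow_pos_of_pos (by linarith) _)
    (Real.rpow_pos_of_pos (inv_pos.2 (Real.cosh_pos _)) _)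

theorem hasDerivAt_solitonQ {p : ℝ} (hp : 1 < p) (x : ℝ) :
    HasDerivAt (solitonQ p) (-(Real.tanh ((p - 1) / 2 * x) * solitonQ p x)) x := by
  have hc : HasDerivAt (fun x : ℝ => (p - 1) / 2 * x) ((p - 1) / 2) x := by
    simpa using (hasDerivAt_id x).const_mul ((p - 1) / 2)
  have hpos := Real.cosh_pos ((p - 1) / 2 * x)
  have h := (((hc.cosh.inv hpos.ne').rpow_const (p := 2 / (p - 1))
    (Or.inl (inv_pos.2 hpos).ne'))).const_mul (((p + 1) / 2) ^ (1 / (p - 1)))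
  refine h.congr_deriv ?_
  have hp' : p - 1 ≠ 0 := by linarith
  simp only [solitonQ, Pi.inv_apply]
  rw [Real.rpow_sub_one (inv_pos.2 hpos).ne', Real.tanh_eq_sinh_div_cosh]
  field_simp

theorem continuous_solitonQ {p : ℝ} (hp : 1 < p) : Continuous (solitonQ p) :=
  continuous_iff_continuousAt.2 fun x => (hasDerivAt_solitonQ hp x).continuousAt

theorem hasDerivAt_solitonQ_rpow {p : ℝ} (hp : 1 < p) (k x : ℝ) :
    HasDerivAt (fun x => solitonQ p x ^ k)
      (-(k * Real.tanh ((p - 1) / 2 * x) * solitonQ p x ^ k)) x := by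
  have hpos := solitonQ_pos hp x
  refine ((hasDerivAt_solitonQ hp x).rpow_const (p := k) (Or.inl hpos.ne')).congr_deriv ?_
  rw [Real.rpow_sub_one hpos.ne']
  field_simp

theorem continuous_solitonQ_rpow {p : ℝ} (hp : 1 < p) (k : ℝ) :
    Continuous fun x => solitonQ p x ^ k :=
  (continuous_solitonQ hp).rpow_const fun x => Or.inl (solitonQ_pos hp x).ne'

theorem hasDerivAt_tanh (x : ℝ) : HasDerivAt Real.tanh (1 - Real.tanh x ^ 2) x := by
  have h := (Real.hasDerivAt_sinh x).div (Real.hasDerivAt_cosh x) (Real.cosh_pos x).ne'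
  have he : Real.tanh = Real.sinh / Real.cosh := funext Real.tanh_eq_sinh_div_cosh
  rw [he]
  refine h.congr_deriv ?_
  have := (Real.cosh_pos x).ne'
  simp only [Pi.div_apply]
  field_simp

theorem phi2_eq {p : ℝ} (hp : 1 < p) (x : ℝ) :
    phi2 p x = ((p - 1) / 2) ^ 2 * (1 + Real.tanh ((p - 1) / 2 * x) ^ 2) *
      solitonQ p x ^ ((3 - p) / 2) := by
  have h1 : Sstar p 1 (fun x => solitonQ p x ^ ((3 - p) / 2)) = fun x =>
      -((p - 1) / 2) * (Real.tanh ((p - 1) / 2 * x) * solitonQ p x ^ ((3 - p) / 2)) := by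
    funext x
    simp only [Sstar, (hasDerivAt_solitonQ_rpow hp _ x).deriv]
    ring
  have hc : HasDerivAt (fun x : ℝ => (p - 1) / 2 * x) ((p - 1) / 2) x := by
    simpa using (hasDerivAt_id x).const_mul ((p - 1) / 2)
  have ht : HasDerivAt (fun x => Real.tanh ((p - 1) / 2 * x)) _ x :=
    (hasDerivAt_tanh ((p - 1) / 2 * x)).comp x hc
  have h2 := (ht.fun_mul (hasDerivAt_solitonQ_rpow hp ((3 - p) / 2) x)).const_mul (-((p - 1) / 2))
  rw [phi2, h1]
  simp only [Sstar, h2.deriv]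
  ring

theorem continuous_phi0 {p : ℝ} (hp : 1 < p) : Continuous (phi0 p) :=
  continuous_solitonQ_rpow hp _

theorem continuous_phi2 {p : ℝ} (hp : 1 < p) : Continuous (phi2 p) := by
  rw [show phi2 p = _ from funext (phi2_eq hp)]
  have ht : Continuous Real.tanh :=
    continuous_iff_continuousAt.2 fun x => (hasDerivAt_tanh x).continuousAt
  exact (continuous_const.mul (continuous_const.add
    ((ht.comp (continuous_const.mul continuous_id)).pow 2))).mul (continuous_solitonQ_rpow hp _)

theorem phi0_pos {p : ℝ} (hp : 1 < p) (x : ℝ) : 0 < phi0 p x :=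
  Real.rpow_pos_of_pos (solitonQ_pos hp x) _

theorem exists_phi_le {p : ℝ} (hp : 1 < p) : ∃ K : ℝ, 0 < K ∧ ∀ x,
    |phi0 p x| ≤ K * solitonQ p x ^ ((3 - p) / 2) ∧
    |phi2 p x| ≤ K * solitonQ p x ^ ((3 - p) / 2) := by
  set M : ℝ := ((p + 1) / 2) ^ (1 / (p - 1))
  have hM : 0 < M := Real.rpow_pos_of_pos (by linarith) _
  have hMp : 0 < M ^ (p - 1) := Real.rpow_pos_of_pos hM _
  refine ⟨M ^ (p - 1) + 2 * ((p - 1) / 2) ^ 2, by positivity, fun x => ?_⟩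
  have hg : 0 < solitonQ p x ^ ((3 - p) / 2) := Real.rpow_pos_of_pos (solitonQ_pos hp x) _
  have hQ : solitonQ p x ≤ M := by
    have : ((Real.cosh ((p - 1) / 2 * x))⁻¹) ^ (2 / (p - 1)) ≤ 1 :=
      Real.rpow_le_one (inv_pos.2 (Real.cosh_pos _)).le (inv_le_one_of_one_le₀ (Real.one_le_cosh _))
        (div_nonneg (by norm_num) (by linarith))
    calc solitonQ p x ≤ M * 1 := mul_le_mul_of_nonneg_left this hM.le
      _ = M := mul_one M
  constructor
  · rw [abs_of_pos (phi0_pos hp x), phi0, show (p + 1) / 2 = (p - 1) + (3 - p) / 2 by ring,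
      Real.rpow_add (solitonQ_pos hp x)]
    refine mul_le_mul_of_nonneg_right ?_ hg.le
    have := Real.rpow_le_rpow (solitonQ_pos hp x).le hQ (by linarith : 0 ≤ p - 1)
    nlinarith [sq_nonneg ((p - 1) / 2)]
  · rw [phi2_eq hp, abs_of_nonneg (by positivity)]
    refine mul_le_mul_of_nonneg_right ?_ hg.le
    nlinarith [Real.tanh_sq_lt_one ((p - 1) / 2 * x), sq_nonneg ((p - 1) / 2)]

theorem integrable_inv_cosh_rpow {b r : ℝ} (hb : 0 < b) (hr : 0 < r) :
    Integrable fun x : ℝ => ((Real.cosh (b * x))⁻¹) ^ r := by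
  have hpos : ∀ x : ℝ, 0 < (Real.cosh (b * x))⁻¹ := fun x => inv_pos.2 (Real.cosh_pos _)
  have hcont : Continuous fun x : ℝ => ((Real.cosh (b * x))⁻¹) ^ r :=
    ((Real.continuous_cosh.comp (continuous_const.mul continuous_id)).inv₀
      fun x => (Real.cosh_pos _).ne').rpow_const fun x => Or.inl (hpos x).ne'
  have key : ∀ s : ℝ, ∀ x : ℝ, (∀ y, Real.exp (s * y) / 2 ≤ Real.cosh y) →
      ‖((Real.cosh (b * x))⁻¹) ^ r‖ ≤ 2 ^ r * Real.exp (-s * (b * r) * x) := by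
    intro s x h
    rw [Real.norm_of_nonneg (Real.rpow_nonneg (hpos x).le r)]
    have h1 : (Real.cosh (b * x))⁻¹ ≤ 2 * Real.exp (-s * b * x) := by
      have := inv_anti₀ (by positivity) (h (b * x))
      refine this.trans (le_of_eq ?_)
      rw [inv_div, div_eq_mul_inv, ← Real.exp_neg]
      ring_nf
    calc _ ≤ (2 * Real.exp (-s * b * x)) ^ r := Real.rpow_le_rpow (hpos x).le h1 hr.le
      _ = _ := by
        rw [Real.mul_rpow (by norm_num) (Real.exp_pos _).le, ← Real.exp_mul]
        ring_nf
  have hbr : 0 < b * r := mul_pos hb hr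
  rw [← integrableOn_univ, ← Set.Iic_union_Ioi (a := (0 : ℝ))]
  refine IntegrableOn.union ?_ ?_
  · refine Integrable.mono' ((integrableOn_exp_mul_Iic hbr 0).const_mul (2 ^ r))
      hcont.aestronglyMeasurable (ae_of_all _ fun x => ?_)
    have := key (-1) x fun y => by
      rw [Real.cosh_eq, neg_one_mul]
      linarith [Real.exp_pos y]
    simpa using this
  · refine Integrable.mono' ((integrableOn_exp_mul_Ioi (neg_lt_zero.2 hbr) 0).const_mul (2 ^ r))
      hcont.aestronglyMeasurable (ae_of_all _ fun x => ?_)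
    have := key 1 x fun y => by
      rw [Real.cosh_eq, one_mul]
      linarith [Real.exp_pos (-y)]
    simpa using this

theorem integrable_solitonQ_rpow {p s : ℝ} (hp : 1 < p) (hs : 0 < s) :
    Integrable fun x => solitonQ p x ^ s := by
  have h := (integrable_inv_cosh_rpow (b := (p - 1) / 2) (r := 2 / (p - 1) * s) (by linarith)
    (mul_pos (div_pos two_pos (by linarith)) hs)).const_mul ((((p + 1) / 2) ^ (1 / (p - 1))) ^ s)
  refine h.congr (ae_of_all _ fun x => ?_)
  have h1 : 0 ≤ (Real.cosh ((p - 1) / 2 * x))⁻¹ := (inv_pos.2 (Real.cosh_pos _)).le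
  simp only [solitonQ]
  rw [Real.mul_rpow (Real.rpow_nonneg (by linarith) _) (Real.rpow_nonneg h1 _), Real.rpow_mul h1]

theorem integrable_mul_of_le_solitonQ {p K : ℝ} (hp1 : 1 < p) (hp2 : p ≤ 2)
    {f g : ℝ → ℝ} (hf : Continuous f) (hg : Continuous g)
    (hfK : ∀ x, |f x| ≤ K * solitonQ p x ^ ((3 - p) / 2))
    (hgK : ∀ x, |g x| ≤ K * solitonQ p x ^ ((3 - p) / 2)) : Integrable fun x => f x * g x := by
  refine ((integrable_solitonQ_rpow (s := 3 - p) hp1 (by linarith)).const_mul (K ^ 2)).mono'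
    (hf.mul hg).aestronglyMeasurable (ae_of_all _ fun x => ?_)
  have hQ := solitonQ_pos hp1 x
  rw [Real.norm_eq_abs, abs_mul]
  calc |f x| * |g x| ≤ (K * solitonQ p x ^ ((3 - p) / 2)) * (K * solitonQ p x ^ ((3 - p) / 2)) :=
        mul_le_mul (hfK x) (hgK x) (abs_nonneg _) ((abs_nonneg _).trans (hfK x))
    _ = K ^ 2 * (solitonQ p x ^ ((3 - p) / 2) * solitonQ p x ^ ((3 - p) / 2)) := by ring
    _ = _ := by rw [← Real.rpow_add hQ]; ring_nf

theorem gram_det_ne_zero {p : ℝ} (hp1 : 1 < p)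
    (h00 : Integrable fun x => phi0 p x * phi0 p x)
    (h02 : Integrable fun x => phi0 p x * phi2 p x)
    (h22 : Integrable fun x => phi2 p x * phi2 p x) :
    (∫ x, phi0 p x * phi0 p x) * (∫ x, phi2 p x * phi2 p x)
      - (∫ x, phi0 p x * phi2 p x) ^ 2 ≠ 0 := by
  set a := ∫ x, phi0 p x * phi0 p x with ha
  set b := ∫ x, phi0 p x * phi2 p x with hb
  set c := ∫ x, phi2 p x * phi2 p x with hc
  intro hdet
  have ha0 : a ≠ 0 := by
    intro h
    rw [ha, integral_eq_zero_iff_of_nonneg (fun x => mul_self_nonneg (phi0 p x)) h00] at h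
    have h' := (Continuous.ae_eq_iff_eq volume ((continuous_phi0 hp1).mul (continuous_phi0 hp1))
      continuous_zero).1 h
    have := congrFun h' 0
    simp [(phi0_pos hp1 0).ne'] at this
  have hexp : (fun x => (b * phi0 p x - a * phi2 p x) * (b * phi0 p x - a * phi2 p x)) = fun x =>
      b ^ 2 * (phi0 p x * phi0 p x) - 2 * a * b * (phi0 p x * phi2 p x)
        + a ^ 2 * (phi2 p x * phi2 p x) := by
    funext x
    ring
  have hsub : Integrable fun x =>
      b ^ 2 * (phi0 p x * phi0 p x) - 2 * a * b * (phi0 p x * phi2 p x) :=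
    (h00.const_mul _).sub (h02.const_mul _)
  have hWint : Integrable fun x => (b * phi0 p x - a * phi2 p x) * (b * phi0 p x - a * phi2 p x) := by
    rw [hexp]
    exact hsub.add (h22.const_mul _)
  have hzero : ∫ x, (b * phi0 p x - a * phi2 p x) * (b * phi0 p x - a * phi2 p x) = 0 := by
    rw [hexp, integral_add hsub (h22.const_mul _),
      integral_sub (h00.const_mul _) (h02.const_mul _), integral_const_mul, integral_const_mul,
      integral_const_mul, ← ha, ← hb, ← hc]
    linear_combination a * hdet
  rw [integral_eq_zero_iff_of_nonneg (fun x => mul_self_nonneg _) hWint] at hzero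
  have hcont : Continuous fun x => b * phi0 p x - a * phi2 p x :=
    (continuous_const.mul (continuous_phi0 hp1)).sub (continuous_const.mul (continuous_phi2 hp1))
  have hfun := (Continuous.ae_eq_iff_eq volume (hcont.mul hcont) continuous_zero).1 hzero
  have hlin : ∀ x, b * phi0 p x = a * phi2 p x := fun x =>
    sub_eq_zero.1 (mul_self_eq_zero.1 (congrFun hfun x))
  have hβ : (p - 1) / 2 ≠ 0 := by linarith
  have hred : ∀ x, b * solitonQ p x ^ (p - 1) =
      a * (((p - 1) / 2) ^ 2 * (1 + Real.tanh ((p - 1) / 2 * x) ^ 2)) := by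
    intro x
    have hg : solitonQ p x ^ ((3 - p) / 2) ≠ 0 :=
      (Real.rpow_pos_of_pos (solitonQ_pos hp1 x) _).ne'
    have h := hlin x
    rw [phi2_eq hp1, phi0, show (p + 1) / 2 = (p - 1) + (3 - p) / 2 by ring,
      Real.rpow_add (solitonQ_pos hp1 x)] at h
    exact mul_right_cancel₀ hg (by linarith)
  have hQ : ∀ x, solitonQ p x ^ (p - 1) = (p + 1) / 2 * (1 - Real.tanh ((p - 1) / 2 * x) ^ 2) := by
    intro x
    have h1 : 0 < (Real.cosh ((p - 1) / 2 * x))⁻¹ := inv_pos.2 (Real.cosh_pos _)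
    have hp' : p - 1 ≠ 0 := by linarith
    rw [solitonQ, Real.mul_rpow (Real.rpow_nonneg (by linarith) _) (Real.rpow_nonneg h1.le _),
      ← Real.rpow_mul h1.le, ← Real.rpow_mul (by linarith), div_mul_cancel₀ _ hp',
      div_mul_cancel₀ _ hp', Real.rpow_one, Real.rpow_two, Real.tanh_eq_sinh_div_cosh]
    have h2 := (Real.cosh_pos ((p - 1) / 2 * x)).ne'
    field_simp
    rw [Real.cosh_sq]
    ring
  have e0 := hred 0
  have e1 := hred (1 / ((p - 1) / 2))
  rw [hQ] at e0 e1
  rw [mul_one_div_cancel hβ] at e1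
  simp only [mul_zero, Real.tanh_zero] at e0
  have ht : Real.tanh 1 ≠ 0 := by
    rw [Real.tanh_eq_sinh_div_cosh]
    exact (div_pos (Real.sinh_pos_iff.2 one_pos) (Real.cosh_pos 1)).ne'
  have : a * (((p - 1) / 2) ^ 2 * (2 * Real.tanh 1 ^ 2)) = 0 := by
    linear_combination (1 - Real.tanh 1 ^ 2) * e0 - e1
  simp [ha0, hβ, ht] at this

end Soliton

section Correction

/-- The real-linear functionals `w ↦ tildePhi1 p w x`, indexed by the point `x`. -/
noncomputable def tildePhi1CLM (p : ℝ) (x : ℝ) : ℂ × ℂ →L[ℝ] ℝ :=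
  phi0 p x • ((Complex.reCLM + Complex.imCLM).comp (ContinuousLinearMap.fst ℝ ℂ ℂ)) +
    phi2 p x • ((2 : ℝ) • Complex.reCLM.comp (ContinuousLinearMap.snd ℝ ℂ ℂ))

theorem tildePhi1CLM_apply (p x : ℝ) (w : ℂ × ℂ) : tildePhi1CLM p x w = tildePhi1 p w x := by
  have h : (w.1 * ((1 - Complex.I) / 2)).re = (w.1.re + w.1.im) / 2 := by
    rw [← mul_div_assoc, show (2 : ℂ) = ((2 : ℝ) : ℂ) by norm_num, Complex.div_ofReal_re]
    simp
  rw [tildePhi1, h]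
  simp [tildePhi1CLM]
  ring

theorem continuous_tildePhi1CLM {p : ℝ} (hp : 1 < p) : Continuous (tildePhi1CLM p) :=
  ((continuous_phi0 hp).smul continuous_const).add ((continuous_phi2 hp).smul continuous_const)

theorem hatR2_mul_eq (p : ℝ) (ψ : ℝ → ℝ) (z : ℂ × ℂ) (x : ℝ) :
    hatR2 p z x * ψ x = -taylorRem p (solitonQ p) ψ (tildePhi1CLM p) z x := by
  rw [taylorRem, hatR2, tildePhi1CLM_apply]
  ring

theorem integrable_weight {p K : ℝ} (hp1 : 1 < p) (hp2 : p ≤ 2) (hK : 0 < K)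
    (h0 : ∀ x, |phi0 p x| ≤ K * solitonQ p x ^ ((3 - p) / 2))
    (h2 : ∀ x, |phi2 p x| ≤ K * solitonQ p x ^ ((3 - p) / 2))
    {ψ : ℝ → ℝ} (hψ : Continuous ψ) (hψK : ∀ x, |ψ x| ≤ K * solitonQ p x ^ ((3 - p) / 2)) :
    Integrable fun x => solitonQ p x ^ (p - 2) * ‖tildePhi1CLM p x‖ ^ 2 * |ψ x| := by
  obtain ⟨M, hM, hL⟩ : ∃ M : ℝ, 0 ≤ M ∧
      ∀ x, ‖tildePhi1CLM p x‖ ≤ M * solitonQ p x ^ ((3 - p) / 2) := by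
    refine ⟨K * (‖(Complex.reCLM + Complex.imCLM).comp (ContinuousLinearMap.fst ℝ ℂ ℂ)‖ +
      ‖(2 : ℝ) • Complex.reCLM.comp (ContinuousLinearMap.snd ℝ ℂ ℂ)‖), by positivity,
      fun x => ?_⟩
    refine (norm_add_le _ _).trans ?_
    rw [norm_smul, norm_smul, Real.norm_eq_abs, Real.norm_eq_abs]
    have e0 := mul_le_mul_of_nonneg_right (h0 x)
      (norm_nonneg ((Complex.reCLM + Complex.imCLM).comp (ContinuousLinearMap.fst ℝ ℂ ℂ)))
    have e2 := mul_le_mul_of_nonneg_right (h2 x)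
      (norm_nonneg ((2 : ℝ) • Complex.reCLM.comp (ContinuousLinearMap.snd ℝ ℂ ℂ)))
    linarith
  refine ((integrable_solitonQ_rpow (s := (5 - p) / 2) hp1 (by linarith)).const_mul
    (M ^ 2 * K)).mono' ?_ (ae_of_all _ fun x => ?_)
  · exact (((continuous_solitonQ_rpow hp1 _).mul
      ((continuous_tildePhi1CLM hp1).norm.pow 2)).mul hψ.abs).aestronglyMeasurable
  · have hQ := solitonQ_pos hp1 x
    have hQ2 : 0 < solitonQ p x ^ (p - 2) := Real.rpow_pos_of_pos hQ _
    have hg : 0 < solitonQ p x ^ ((3 - p) / 2) := Real.rpow_pos_of_pos hQ _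
    rw [Real.norm_of_nonneg (by positivity)]
    calc _ ≤ solitonQ p x ^ (p - 2) * (M * solitonQ p x ^ ((3 - p) / 2)) ^ 2 *
          (K * solitonQ p x ^ ((3 - p) / 2)) := by
          gcongr
          · exact hL x
          · exact hψK x
      _ = M ^ 2 * K * (solitonQ p x ^ (p - 2) * (solitonQ p x ^ ((3 - p) / 2) *
          solitonQ p x ^ ((3 - p) / 2) * solitonQ p x ^ ((3 - p) / 2))) := by ring
      _ = _ := by
          rw [← Real.rpow_add hQ, ← Real.rpow_add hQ, ← Real.rpow_add hQ]
          ring_nf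

/-- The parameter `w` for which `tildePhi1 p w = 0` and `tildePhi2 p w = α φ₀ + β φ₂`. -/
noncomputable def secondComponentParam (p α β : ℝ) : ℂ × ℂ :=
  α • (⟨1 / (2 * nu0 p), -(1 / (2 * nu0 p))⟩, 0) + β • (0, ⟨0, -(1 / (2 * lam p))⟩)

theorem tildePhi1_secondComponentParam (p α β x : ℝ) :
    tildePhi1 p (secondComponentParam p α β) x = 0 := by
  rw [← tildePhi1CLM_apply]
  simp [tildePhi1CLM, secondComponentParam]

theorem tildePhi2_secondComponentParam {p : ℝ} (hp1 : 1 < p) (hp2 : p ≤ 2) (α β x : ℝ) :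
    tildePhi2 p (secondComponentParam p α β) x = α * phi0 p x + β * phi2 p x := by
  have hν : nu0 p ≠ 0 := (Real.sqrt_pos.2 (by nlinarith)).ne'
  have hl : lam p ≠ 0 := (Real.sqrt_pos.2 (by nlinarith)).ne'
  have h (w : ℂ) : (w * ((1 + Complex.I) / 2)).re = (w.re - w.im) / 2 := by
    rw [← mul_div_assoc, show (2 : ℂ) = ((2 : ℝ) : ℂ) by norm_num, Complex.div_ofReal_re]
    simp
  rw [tildePhi2, h]
  simp [secondComponentParam]
  field_simp

end Correction

open MeasureTheory in
theorem stmt19 (p : ℝ) (hp1 : 5 / 3 < p) (hp2 : p ≤ 2) :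
    ∃ C₁ > (0 : ℝ), ∃ δ₁ > (0 : ℝ), ∃ zR : ℂ × ℂ → ℂ × ℂ,
      (∀ z : ℂ × ℂ, ‖z‖ < δ₁ → ∀ Θ : ℂ × ℂ,
        ∫ x : ℝ,
          ((tildePhi2 p (zR z) x + hatR2 p z x) * tildePhi1 p Θ x
            - (tildePhi1 p (zR z) x + hatR1 p z x) * tildePhi2 p Θ x) = 0) ∧
      (∀ z : ℂ × ℂ, ‖z‖ < δ₁ → ‖zR z‖ ≤ C₁ * ‖z‖ ^ 2) ∧
      ContDiffOn ℝ 1 zR (Metric.ball (0 : ℂ × ℂ) δ₁) ∧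
      DifferentiableAt ℝ (fderiv ℝ zR) (0 : ℂ × ℂ) := by
  have hp : 1 < p := by linarith
  obtain ⟨K, hK, hφ⟩ := exists_phi_le hp
  have hφ0 := fun x => (hφ x).1
  have hφ2 := fun x => (hφ x).2
  have hQ := continuous_solitonQ hp
  have hQ0 := solitonQ_pos hp
  have hc0 := continuous_phi0 hp
  have hc2 := continuous_phi2 hp
  have hL := continuous_tildePhi1CLM hp
  have h00 := integrable_mul_of_le_solitonQ hp hp2 hc0 hc0 hφ0 hφ0
  have h02 := integrable_mul_of_le_solitonQ hp hp2 hc0 hc2 hφ0 hφ2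
  have h22 := integrable_mul_of_le_solitonQ hp hp2 hc2 hc2 hφ2 hφ2
  have hW0 := integrable_weight hp hp2 hK hφ0 hφ2 hc0 hφ0
  have hW2 := integrable_weight hp hp2 hK hφ0 hφ2 hc2 hφ2
  have hdet := gram_det_ne_zero hp h00 h02 h22
  set a := ∫ x, phi0 p x * phi0 p x
  set b := ∫ x, phi0 p x * phi2 p x
  set c := ∫ x, phi2 p x * phi2 p x
  set r0 : ℂ × ℂ → ℝ := fun z => ∫ x, taylorRem p (solitonQ p) (phi0 p) (tildePhi1CLM p) z x
  set r2 : ℂ × ℂ → ℝ := fun z => ∫ x, taylorRem p (solitonQ p) (phi2 p) (tildePhi1CLM p) z x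
  set v0 : ℂ × ℂ := secondComponentParam p (c / (a * c - b ^ 2)) (-(b / (a * c - b ^ 2))) with hv0
  set v2 : ℂ × ℂ := secondComponentParam p (-(b / (a * c - b ^ 2))) (a / (a * c - b ^ 2)) with hv2
  have hzR : ∀ z, r0 z • v0 + r2 z • v2 = secondComponentParam p
      ((c * r0 z - b * r2 z) / (a * c - b ^ 2)) ((a * r2 z - b * r0 z) / (a * c - b ^ 2)) := by
    intro z
    simp only [hv0, hv2, secondComponentParam]
    module
  have hb0 := norm_integral_taylorRem_le hp hp2 hQ0 hW0
  have hb2 := norm_integral_taylorRem_le hp hp2 hQ0 hW2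
  set C0 := p * ∫ x, solitonQ p x ^ (p - 2) * ‖tildePhi1CLM p x‖ ^ 2 * |phi0 p x|
  set C2 := p * ∫ x, solitonQ p x ^ (p - 2) * ‖tildePhi1CLM p x‖ ^ 2 * |phi2 p x|
  have hpos : ∀ ψ : ℝ → ℝ,
      0 ≤ p * ∫ x, solitonQ p x ^ (p - 2) * ‖tildePhi1CLM p x‖ ^ 2 * |ψ x| := fun ψ =>
    mul_nonneg (by linarith) (integral_nonneg fun x =>
      mul_nonneg (mul_nonneg (Real.rpow_nonneg (hQ0 x).le _) (sq_nonneg _)) (abs_nonneg _))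
  have hC0pos : 0 ≤ C0 := hpos _
  have hC2pos : 0 ≤ C2 := hpos _
  have hd0 : ContDiff ℝ 1 r0 := contDiff_integral_taylorRem hp hp2 hQ hQ0 hc0 hL hW0
  have hd2 : ContDiff ℝ 1 r2 := contDiff_integral_taylorRem hp hp2 hQ hQ0 hc2 hL hW2
  refine ⟨C0 * ‖v0‖ + C2 * ‖v2‖ + 1, by positivity, 1, one_pos,
    fun z => r0 z • v0 + r2 z • v2, ?_, ?_, ?_, ?_⟩
  · intro z _ Θ
    set α := (c * r0 z - b * r2 z) / (a * c - b ^ 2) with hα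
    set β := (a * r2 z - b * r0 z) / (a * c - b ^ 2) with hβ
    set A := 2 * (Θ.1 * ((1 - Complex.I) / 2)).re
    set B := 2 * Θ.2.re
    have hi0 := integrable_taylorRem hp hp2 hQ hQ0 hc0 hL hW0 z
    have hi2 := integrable_taylorRem hp hp2 hQ hQ0 hc2 hL hW2 z
    have hexp : ∀ x, (tildePhi2 p (r0 z • v0 + r2 z • v2) x + hatR2 p z x) * tildePhi1 p Θ x
        - (tildePhi1 p (r0 z • v0 + r2 z • v2) x + hatR1 p z x) * tildePhi2 p Θ x =
        (A * α * (phi0 p x * phi0 p x) + (A * β + B * α) * (phi0 p x * phi2 p x)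
          + B * β * (phi2 p x * phi2 p x))
        - (A * taylorRem p (solitonQ p) (phi0 p) (tildePhi1CLM p) z x
          + B * taylorRem p (solitonQ p) (phi2 p) (tildePhi1CLM p) z x) := by
      intro x
      have e0 := hatR2_mul_eq p (phi0 p) z x
      have e2 := hatR2_mul_eq p (phi2 p) z x
      rw [hzR, tildePhi1_secondComponentParam, tildePhi2_secondComponentParam hp hp2, hatR1]
      simp only [tildePhi1]
      linear_combination A * e0 + B * e2
    have i1 : Integrable fun x =>
        A * α * (phi0 p x * phi0 p x) + (A * β + B * α) * (phi0 p x * phi2 p x) :=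
      (h00.const_mul _).add (h02.const_mul _)
    have i2 : Integrable fun x =>
        A * α * (phi0 p x * phi0 p x) + (A * β + B * α) * (phi0 p x * phi2 p x)
          + B * β * (phi2 p x * phi2 p x) := i1.add (h22.const_mul _)
    have i3 : Integrable fun x => A * taylorRem p (solitonQ p) (phi0 p) (tildePhi1CLM p) z x
          + B * taylorRem p (solitonQ p) (phi2 p) (tildePhi1CLM p) z x :=
      (hi0.const_mul _).add (hi2.const_mul _)
    rw [integral_congr_ae (ae_of_all _ hexp), integral_sub i2 i3,
      integral_add i1 (h22.const_mul _), integral_add (h00.const_mul _) (h02.const_mul _),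
      integral_add (hi0.const_mul _) (hi2.const_mul _)]
    simp only [integral_const_mul]
    change A * α * a + (A * β + B * α) * b + B * β * c - (A * r0 z + B * r2 z) = 0
    have s0 : α * a + β * b = r0 z := by
      rw [hα, hβ, div_mul_eq_mul_div, div_mul_eq_mul_div, ← add_div, div_eq_iff hdet]
      ring
    have s2 : α * b + β * c = r2 z := by
      rw [hα, hβ, div_mul_eq_mul_div, div_mul_eq_mul_div, ← add_div, div_eq_iff hdet]
      ring
    linear_combination A * s0 + B * s2
  · intro z _
    have e0 : ‖r0 z‖ ≤ C0 * ‖z‖ ^ 2 := hb0 z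
    have e2 : ‖r2 z‖ ≤ C2 * ‖z‖ ^ 2 := hb2 z
    calc ‖r0 z • v0 + r2 z • v2‖ ≤ ‖r0 z‖ * ‖v0‖ + ‖r2 z‖ * ‖v2‖ := by
          rw [← norm_smul, ← norm_smul]
          exact norm_add_le _ _
      _ ≤ C0 * ‖z‖ ^ 2 * ‖v0‖ + C2 * ‖z‖ ^ 2 * ‖v2‖ := by gcongr
      _ ≤ _ := by nlinarith [sq_nonneg ‖z‖]
  · exact ((hd0.smul contDiff_const).add (hd2.smul contDiff_const)).contDiffOn
  · have hf : fderiv ℝ (fun z => r0 z • v0 + r2 z • v2) = fun z =>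
        (ContinuousLinearMap.toSpanSingleton ℝ v0).comp (fderiv ℝ r0 z) +
          (ContinuousLinearMap.toSpanSingleton ℝ v2).comp (fderiv ℝ r2 z) := by
      funext z
      have g0 := (hd0.differentiable one_ne_zero z).hasFDerivAt
      have g2 := (hd2.differentiable one_ne_zero z).hasFDerivAt
      exact (((ContinuousLinearMap.toSpanSingleton ℝ v0).hasFDerivAt.comp z g0).add
        ((ContinuousLinearMap.toSpanSingleton ℝ v2).hasFDerivAt.comp z g2)).fderiv
    rw [hf]
    exact ((differentiableAt_const _).clm_comp
        (differentiableAt_fderiv_integral_taylorRem hp hp2 hQ hQ0 hc0 hL hW0)).add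
      ((differentiableAt_const _).clm_comp
        (differentiableAt_fderiv_integral_taylorRem hp hp2 hQ hQ0 hc2 hL hW2))
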